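/- arXiv:2304.07939 — 7 statements merged into one kernel-verified Lean document; each statement's English description precedes it below -/
import Mathlib

section
/- Let d : ℕ and let h : (Fin d → ℝ) → (Fin d → ℝ) be a homeomorphism (a continuous bijection with continuous inverse; in the paper h = (g*)⁻¹∘g for smooth diffeomorphisms g, g*). Let 𝒮 be a family of subsets of Fin d such that for every index i ∈ Fin d, either there exist S, S' ∈ 𝒮 with S ∩ S' = {i}, or there exist S, S' ∈ 𝒮 with (S ∪ S') \ (S ∩ S') = {i}. Assume that for every S ∈ 𝒮 there exists a set T ⊆ Fin d such that (S, T) is an admissible block pair for h. Then there exist a permutation π of Fin d and functions g_i : ℝ → ℝ, each of which is a bijection of ℝ, such that h z i = g_i (z (π i)) for all z : Fin d → ℝ and all i : Fin d; in other words, h is an axis-aligned, component-wise invertible transformation up to a permutation of the coordinates. -/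
/-- `F` depends only on the coordinates in `A`. -/
def DependsOnlyOn {d : ℕ} {Y : Type*} (F : (Fin d → ℝ) → Y) (A : Set (Fin d)) : Prop :=
  ∀ z z' : Fin d → ℝ, (∀ j ∈ A, z j = z' j) → F z = F z'

/-- `(S, T)` is an admissible block pair for `h`: every component of `h` with index in `T`
depends only on `S`, and every component with index in `Tᶜ` depends only on `Sᶜ`. -/
def AdmissibleBlockPair {d : ℕ} (h : (Fin d → ℝ) → (Fin d → ℝ))
    (S T : Set (Fin d)) : Prop :=
  (∀ i ∈ T, DependsOnlyOn (fun z => h z i) S) ∧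
  (∀ i ∈ Tᶜ, DependsOnlyOn (fun z => h z i) Sᶜ)

theorem aux_dep {d : ℕ} (F : (Fin d → ℝ) → ℝ) (p : Fin d)
    (hF : ∀ k, k ≠ p → ∀ z a, F (Function.update z k a) = F z)
    (z z' : Fin d → ℝ) (hp : z p = z' p) : F z = F z' := by
  have key : ∀ s : Finset (Fin d), F (s.piecewise z' z) = F z := by
    intro s
    induction s using Finset.induction_on with
    | empty => simp
    | insert k s hk ih =>
      rw [Finset.piecewise_insert]
      by_cases hkp : k = p
      · subst hkp
        have : z' k = s.piecewise z' z k := by simp [hk, hp]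
        rw [this, Function.update_eq_self, ih]
      · rw [hF k hkp, ih]
  have := key Finset.univ
  rw [Finset.piecewise_univ] at this
  exact this.symm

/-- Identifiability core of Proposition 1: under the support-richness condition on the family
of task supports `𝒮` and admissibility of a feature block for each support, the homeomorphism
`h` is an axis-aligned, component-wise invertible transformation up to a permutation. -/
theorem identifiability_axis_aligned
    (d : ℕ) (h : (Fin d → ℝ) ≃ₜ (Fin d → ℝ)) (𝒮 : Set (Set (Fin d)))
    (hrich : ∀ i : Fin d,
      (∃ S ∈ 𝒮, ∃ S' ∈ 𝒮, S ∩ S' = {i}) ∨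
      (∃ S ∈ 𝒮, ∃ S' ∈ 𝒮, (S ∪ S') \ (S ∩ S') = {i}))
    (hadm : ∀ S ∈ 𝒮, ∃ T : Set (Fin d), AdmissibleBlockPair (fun z => h z) S T) :
    ∃ (π : Equiv.Perm (Fin d)) (g : Fin d → ℝ → ℝ),
      (∀ i, Function.Bijective (g i)) ∧
      ∀ (z : Fin d → ℝ) (i : Fin d), h z i = g i (z (π i)) := by
  classical
  have hsep : ∀ j k : Fin d, j ≠ k → ∃ S ∈ 𝒮, ¬ (j ∈ S ↔ k ∈ S) := by
    intro j k hjk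
    by_contra! hc
    rcases hrich j with ⟨S, hS, S', hS', he⟩ | ⟨S, hS, S', hS', he⟩
    all_goals
      have h1 := hc S hS
      have h2 := hc S' hS'
      have hj := Set.ext_iff.1 he j
      have hk := Set.ext_iff.1 he k
      simp only [Set.mem_inter_iff, Set.mem_diff, Set.mem_union, Set.mem_singleton_iff] at hj hk
      have hkj : k ≠ j := hjk.symm
      tauto
  have hess : ∀ (S : Set (Fin d)) (i k : Fin d) (z : Fin d → ℝ) (a : ℝ),
      DependsOnlyOn (fun z => h z i) S → h (Function.update z k a) i ≠ h z i → k ∈ S := by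
    intro S i k z a hd hne
    by_contra hk
    apply hne
    apply hd
    intro j hj
    rw [Function.update_of_ne]
    rintro rfl
    exact hk hj
  have huniq : ∀ i j k : Fin d, (∃ z a, h (Function.update z j a) i ≠ h z i) →
      (∃ z a, h (Function.update z k a) i ≠ h z i) → j = k := by
    rintro i j k ⟨z, a, hj⟩ ⟨w, b, hk⟩
    by_contra hjk
    obtain ⟨S, hS, hn⟩ := hsep j k hjk
    obtain ⟨T, hT, hT'⟩ := hadm S hS
    by_cases hi : i ∈ T
    · have h1 := hess S i j z a (hT i hi) hj
      have h2 := hess S i k w b (hT i hi) hk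
      tauto
    · have h1 := hess Sᶜ i j z a (hT' i hi) hj
      have h2 := hess Sᶜ i k w b (hT' i hi) hk
      simp only [Set.mem_compl_iff] at h1 h2
      tauto
  have hex : ∀ k : Fin d, ∃ i, ∃ z a, h (Function.update z k a) i ≠ h z i := by
    intro k
    by_contra! hc
    have h1 : h (Function.update (fun _ => 0) k 1) = h (fun _ => 0) :=
      funext fun i => hc i _ _
    have h2 := congrFun (h.injective h1) k
    simp at h2
  choose σ hσ using hex
  have hinj : Function.Injective σ := by
    intro j k hjk
    have := hσ j
    rw [hjk] at this
    exact huniq _ _ _ this (hσ k)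
  let e : Equiv.Perm (Fin d) := Equiv.ofBijective σ (Finite.injective_iff_bijective.1 hinj)
  have hπ : ∀ i, ∃ z a, h (Function.update z (e.symm i) a) i ≠ h z i := by
    intro i
    have h1 := hσ (e.symm i)
    have h2 : σ (e.symm i) = i := e.apply_symm_apply i
    rw [h2] at h1
    exact h1
  have hdep : ∀ i z z', z (e.symm i) = z' (e.symm i) → h z i = h z' i := by
    intro i
    apply aux_dep (fun z => h z i)
    intro k hk z a
    by_contra hne
    exact hk (huniq i _ _ ⟨z, a, hne⟩ (hπ i))
  refine ⟨e.symm, fun i x => h (fun _ => x) i, fun i => ⟨?_, ?_⟩, ?_⟩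
  · intro a b hab
    have h1 : h (Function.update (fun _ => a) (e.symm i) b) = h (fun _ => a) := by
      funext j
      by_cases hj : j = i
      · subst hj
        refine Eq.trans ?_ hab.symm
        apply hdep
        simp
      · apply hdep
        rw [Function.update_of_ne]
        exact fun hh => hj (e.symm.injective hh)
    have h2 := congrFun (h.injective h1) (e.symm i)
    simpa using h2.symm
  · intro y
    refine ⟨h.symm (fun _ => y) (e.symm i), ?_⟩
    have h1 : h (h.symm (fun _ => y)) i = y := by simp
    refine Eq.trans ?_ h1
    apply hdep
    rfl
  · intro z i
    apply hdep
    rfl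
end

section
/- Let d : ℕ, Y a type, and F : (Fin d → ℝ) → Y. If F depends only on a set A ⊆ Fin d and F depends only on a set B ⊆ Fin d, then F depends only on A ∩ B. -/
/-- Dependency sets are closed under intersection. -/
theorem dependsOnlyOn_inter (d : ℕ) (Y : Type*) (F : (Fin d → ℝ) → Y)
    (A B : Set (Fin d)) (hA : DependsOnlyOn F A) (hB : DependsOnlyOn F B) :
    DependsOnlyOn F (A ∩ B) := by
  classical
  intro z z' h
  have h1 : F z = F (fun j => if j ∈ A then z j else z' j) :=
    hA _ _ (fun j hj => by simp [hj])
  have h2 : F (fun j => if j ∈ A then z j else z' j) = F z' := by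
    refine hB _ _ (fun j hj => ?_)
    by_cases hjA : j ∈ A
    · simpa [hjA] using h j ⟨hjA, hj⟩
    · simp [hjA]
  exact h1.trans h2
end

section
/- Let d : ℕ and let h : (Fin d → ℝ) → (Fin d → ℝ) be a bijection. Let S, T ⊆ Fin d and assume (S, T) is an admissible block pair for h. Then there exist functions F : ({i // i ∈ S} → ℝ) → ({i // i ∈ T} → ℝ) and G : ({i // i ∉ S} → ℝ) → ({i // i ∉ T} → ℝ) such that for every z : Fin d → ℝ, h z i = F (restriction of z to S) i for every i ∈ T and h z i = G (restriction of z to Sᶜ) i for every i ∉ T; moreover both F and G are bijections. -/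
/-- Block factorization: a bijection `h` with an admissible block pair `(S, T)` factors as a
product of a bijection from the `S`-block to the `T`-block and a bijection from the
`Sᶜ`-block to the `Tᶜ`-block. -/
theorem admissible_block_pair_factorization
    (d : ℕ) (h : (Fin d → ℝ) → (Fin d → ℝ)) (hbij : Function.Bijective h)
    (S T : Set (Fin d)) (hadm : AdmissibleBlockPair h S T) :
    ∃ (F : ({i // i ∈ S} → ℝ) → ({i // i ∈ T} → ℝ))
      (G : ({i // i ∉ S} → ℝ) → ({i // i ∉ T} → ℝ)),
      (∀ (z : Fin d → ℝ) (i : Fin d) (hi : i ∈ T),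
        h z i = F (fun j => z j.val) ⟨i, hi⟩) ∧
      (∀ (z : Fin d → ℝ) (i : Fin d) (hi : i ∉ T),
        h z i = G (fun j => z j.val) ⟨i, hi⟩) ∧
      Function.Bijective F ∧ Function.Bijective G := by
  classical
  obtain ⟨h1, h2⟩ := hadm
  have hF : ∀ (z : Fin d → ℝ) (i : Fin d), i ∈ T →
      h z i = h (fun j => if j ∈ S then z j else 0) i := by
    intro z i hi
    exact h1 i hi _ _ (fun j hj => by simp [hj])
  have hG : ∀ (z : Fin d → ℝ) (i : Fin d), i ∉ T →
      h z i = h (fun j => if j ∈ S then 0 else z j) i := by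
    intro z i hi
    refine h2 i hi _ _ (fun j hj => ?_)
    have hj' : j ∉ S := hj
    simp [hj']
  refine ⟨fun a i => h (fun j => if hj : j ∈ S then a ⟨j, hj⟩ else 0) i.val,
    fun b i => h (fun j => if hj : j ∈ S then 0 else b ⟨j, hj⟩) i.val, ?_, ?_, ⟨?_, ?_⟩, ⟨?_, ?_⟩⟩
  · intro z i hi
    simpa using hF z i hi
  · intro z i hi
    simpa using hG z i hi
  · intro a a' haa
    have key := hbij.1 (a₁ := fun j => if hj : j ∈ S then a ⟨j, hj⟩ else 0)
      (a₂ := fun j => if hj : j ∈ S then a' ⟨j, hj⟩ else 0) (by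
        funext i
        by_cases hi : i ∈ T
        · exact congrFun haa ⟨i, hi⟩
        · refine h2 i hi _ _ (fun j hj => ?_)
          have hj' : j ∉ S := hj
          simp [hj'])
    funext j
    have := congrFun key j.val
    simpa [j.2] using this
  · intro y
    obtain ⟨z, hz⟩ := hbij.2 (fun i => if hi : i ∈ T then y ⟨i, hi⟩ else 0)
    refine ⟨fun j => z j.val, ?_⟩
    funext i
    have e := hF z i.val i.2
    rw [hz] at e
    simpa [i.2] using e.symm
  · intro a a' haa
    have key := hbij.1 (a₁ := fun j => if hj : j ∈ S then 0 else a ⟨j, hj⟩)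
      (a₂ := fun j => if hj : j ∈ S then 0 else a' ⟨j, hj⟩) (by
        funext i
        by_cases hi : i ∈ T
        · exact h1 i hi _ _ (fun j hj => by simp [hj])
        · exact congrFun haa ⟨i, hi⟩)
    funext j
    have := congrFun key j.val
    simpa [j.2] using this
  · intro y
    obtain ⟨z, hz⟩ := hbij.2 (fun i => if hi : i ∈ T then 0 else y ⟨i, hi⟩)
    refine ⟨fun j => z j.val, ?_⟩
    funext i
    have e := hG z i.val i.2
    rw [hz] at e
    simpa [i.2] using e.symm
end

section
/- Let d : ℕ and let h : (Fin d → ℝ) → (Fin d → ℝ) be a homeomorphism (a continuous bijection with continuous inverse). Let S, T ⊆ Fin d and assume (S, T) is an admissible block pair for h. Then the cardinality of T equals the cardinality of S. -/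
section Helpers
open MeasureTheory Set Metric Topology Filter

noncomputable def jac {ι : Type*} [Fintype ι] [DecidableEq ι] (φ : (ι → ℝ) → (ι → ℝ))
    (x : ι → ℝ) : Matrix ι ι ℝ :=
  Matrix.of fun i j => fderiv ℝ φ x (Pi.single j 1) i

theorem jac_cont {ι : Type*} [Fintype ι] [DecidableEq ι] (φ : (ι → ℝ) → (ι → ℝ))
    (hφ : ContDiff ℝ 1 φ) (i j : ι) : Continuous fun x => jac φ x i j := by
  have := hφ.continuous_fderiv (by norm_num)
  simp only [jac, Matrix.of_apply]
  fun_prop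

theorem det_eq {ι : Type*} [Fintype ι] [DecidableEq ι] (φ : (ι → ℝ) → (ι → ℝ))
    (t : ℝ) (x : ι → ℝ) :
    (ContinuousLinearMap.id ℝ (ι → ℝ) + t • fderiv ℝ φ x).det = (1 + t • jac φ x).det := by
  rw [ContinuousLinearMap.det, ← LinearMap.det_toMatrix']
  congr 1
  ext i j
  simp [LinearMap.toMatrix'_apply, jac, Matrix.one_apply, Pi.single_apply]

theorem small_t {ι : Type*} [Fintype ι] [DecidableEq ι] (φ : (ι → ℝ) → (ι → ℝ))
    (hφ : ContDiff ℝ 1 φ) (hs : ∀ x, 1 ≤ ‖x‖ → φ x = 0) :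
    ∀ᶠ t in 𝓝 (0:ℝ), ∀ g : (ι → ℝ) → ℝ,
      ∫ x in closedBall (0 : ι → ℝ) 1, (1 + t • jac φ x).det * g (x + t • φ x)
        = ∫ x in closedBall (0 : ι → ℝ) 1, g x := by
  have hcs : HasCompactSupport φ := by
    apply HasCompactSupport.intro (isCompact_closedBall (0 : ι → ℝ) 1)
    intro x hx
    apply hs
    simp at hx
    exact hx.le
  obtain ⟨K, hK⟩ := hφ.lipschitzWith_of_hasCompactSupport hcs (by norm_num)
  have hdet : ∀ᶠ t in 𝓝 (0:ℝ), ∀ x ∈ closedBall (0 : ι → ℝ) 1, 0 < (1 + t • jac φ x).det := by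
    apply (isCompact_closedBall (0 : ι → ℝ) 1).eventually_forall_of_forall_eventually
    intro x _
    have hc : Continuous fun z : ℝ × (ι → ℝ) => (1 + z.1 • jac φ z.2).det := by
      apply Continuous.matrix_det
      refine continuous_matrix fun i j => ?_
      have := jac_cont φ hφ i j
      simp only [Matrix.add_apply, Matrix.smul_apply]
      fun_prop
    apply hc.continuousAt.eventually_const_lt (u := 0)
    simp
  have hsm : ∀ᶠ t in 𝓝 (0:ℝ), ‖t‖₊ * K < 1 := by
    have : Continuous fun t : ℝ => ‖t‖₊ * K := by fun_prop
    apply this.continuousAt.eventually_lt_const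
    simp
  filter_upwards [hdet, hsm] with t hdet ht g
  have hL : LipschitzWith (‖t‖₊ * K) (fun x => t • φ x) := (lipschitzWith_smul t).comp hK
  have hinj : Function.Injective (fun x => x + t • φ x) := by
    intro x y hxy
    simp only at hxy
    have h1 := hL.dist_le_mul x y
    have h2 : dist (t • φ x) (t • φ y) = dist x y := by
      rw [dist_eq_norm, dist_eq_norm, ← norm_neg]
      congr 1
      rw [neg_sub, sub_eq_sub_iff_add_eq_add, add_comm, ← hxy]
      try abel
    rw [h2] at h1
    by_contra hne
    have := dist_pos.2 hne
    have h3 : ((‖t‖₊ * K : NNReal) : ℝ) < 1 := by exact_mod_cast ht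
    nlinarith
  have hsurj : Function.Surjective (fun x => x + t • φ x) := by
    intro y
    have hcw : ContractingWith (‖t‖₊ * K) (fun x => y - t • φ x) := by
      refine ⟨ht, LipschitzWith.of_dist_le_mul fun a b => ?_⟩
      rw [dist_sub_left]
      exact hL.dist_le_mul a b
    refine ⟨ContractingWith.fixedPoint _ hcw, ?_⟩
    · have := hcw.fixedPoint_isFixedPt
      simp only [Function.IsFixedPt] at this
      exact (sub_eq_iff_eq_add.1 this).symm
  have hout : ∀ x : ι → ℝ, 1 < ‖x‖ → x + t • φ x = x := fun x hx => by simp [hs x hx.le]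
  have himg : (fun x => x + t • φ x) '' closedBall (0 : ι → ℝ) 1 = closedBall (0 : ι → ℝ) 1 := by
    ext y
    simp only [mem_image, mem_closedBall, dist_zero_right]
    constructor
    · rintro ⟨x, hx, rfl⟩
      by_contra! hy
      have h1 := hout _ hy
      have h2 := hinj (a₁ := x + t • φ x) (a₂ := x) h1
      rw [h2] at hy
      linarith
    · intro hy
      obtain ⟨x, rfl⟩ := hsurj y
      refine ⟨x, ?_, rfl⟩
      by_contra! hx
      simp only [hout x hx] at hy
      linarith
  have := integral_image_eq_integral_abs_det_fderiv_smul (volume : Measure (ι → ℝ))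
    (s := closedBall (0 : ι → ℝ) 1) (f := fun x => x + t • φ x)
    (f' := fun x => ContinuousLinearMap.id ℝ (ι → ℝ) + t • fderiv ℝ φ x)
    isClosed_closedBall.measurableSet
    (fun x _ => (((hasFDerivAt_id x).add
      (((hφ.differentiable (by norm_num)) x).hasFDerivAt.const_smul t))).hasFDerivWithinAt)
    hinj.injOn g
  rw [himg] at this
  rw [this]
  apply setIntegral_congr_fun isClosed_closedBall.measurableSet
  intro x hx
  simp only [det_eq, abs_of_pos (hdet x hx), smul_eq_mul]

open Polynomial in
theorem poly_id {ι : Type*} [Fintype ι] [DecidableEq ι] (φ : (ι → ℝ) → (ι → ℝ))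
    (hφ : ContDiff ℝ 1 φ) (hs : ∀ x, 1 ≤ ‖x‖ → φ x = 0) (c : ι → ℝ) (M : ℝ) (k : ℕ) :
      ∫ x in closedBall (0 : ι → ℝ) 1, (1 + jac φ x).det *
          (1 - M * ∑ i, ((x + φ x) i - c i) ^ 2) ^ k
        = ∫ x in closedBall (0 : ι → ℝ) 1, (1 - M * ∑ i, (x i - c i) ^ 2) ^ k := by
  let R := C((ι → ℝ), ℝ)
  let X' : ι → R := fun i => ⟨fun x => x i, by fun_prop⟩
  let Φ : ι → R := fun i => ⟨fun x => φ x i, by have := hφ.continuous; fun_prop⟩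
  let Jm : Matrix ι ι R := Matrix.of fun i j => ⟨fun x => jac φ x i j, jac_cont φ hφ i j⟩
  let P : R[X] := (1 + (X : R[X]) • Jm.map C).det *
    (1 - C (algebraMap ℝ R M) * ∑ i, (C (X' i) + X * C (Φ i) - C (algebraMap ℝ R (c i))) ^ 2) ^ k
  have hev : ∀ (t : ℝ) (x : ι → ℝ), (P.eval (algebraMap ℝ R t)) x =
      (1 + t • jac φ x).det * (1 - M * ∑ i, ((x + t • φ x) i - c i) ^ 2) ^ k := by
    intro t x
    let ev : R →+* ℝ := ⟨⟨⟨fun f => f x, rfl⟩, fun _ _ => rfl⟩, rfl, fun _ _ => rfl⟩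
    let e : R[X] →+* ℝ := ev.comp (evalRingHom (algebraMap ℝ R t))
    have hX : e X = t := by
      simp only [e, RingHom.comp_apply, coe_evalRingHom, eval_X]
      rfl
    have hC : ∀ r : R, e (C r) = r x := by 
      intro r
      simp only [e, RingHom.comp_apply, coe_evalRingHom, eval_C]
      rfl
    change e P = _
    simp only [P, map_mul, map_pow, map_sub, map_one, map_sum, map_add, hX, hC, RingHom.map_det]
    congr 1
    congr 1
    ext i j
    simp only [RingHom.mapMatrix_apply, Matrix.map_apply, Matrix.add_apply, Matrix.smul_apply,
      smul_eq_mul, map_add, map_mul, hX, hC]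
    by_cases hij : i = j <;> simp [Matrix.one_apply, hij, Jm] <;> exact Or.inl rfl
  have hint : ∀ f : R, IntegrableOn f (closedBall (0 : ι → ℝ) 1) := fun f =>
    f.continuous.continuousOn.integrableOn_compact (isCompact_closedBall _ _)
  let I : R →ₗ[ℝ] ℝ :=
    { toFun := fun f => ∫ x in closedBall (0 : ι → ℝ) 1, f x
      map_add' := fun f g => integral_add (hint f) (hint g)
      map_smul' := fun r f => integral_const_mul _ _ }
  let Q : ℝ[X] := ∑ n ∈ Finset.range (P.natDegree + 1), C (I (P.coeff n)) * X ^ n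
  have hQ : ∀ t : ℝ, Q.eval t = ∫ x in closedBall (0 : ι → ℝ) 1, (1 + t • jac φ x).det *
          (1 - M * ∑ i, ((x + t • φ x) i - c i) ^ 2) ^ k := by
    intro t
    have : I (P.eval (algebraMap ℝ R t)) = Q.eval t := by
      rw [eval_eq_sum_range, map_sum]
      simp only [Q, eval_finsetSum, eval_mul, eval_C, eval_pow, eval_X]
      refine Finset.sum_congr rfl fun n _ => ?_
      rw [← map_pow, mul_comm, ← Algebra.smul_def, map_smul, smul_eq_mul, mul_comm]
    rw [← this]
    simp only [I, LinearMap.coe_mk, AddHom.coe_mk, hev]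
  have hconst : Q = C (∫ x in closedBall (0 : ι → ℝ) 1, (1 - M * ∑ i, (x i - c i) ^ 2) ^ k) := by
    apply eq_of_infinite_eval_eq
    have h1 := small_t φ hφ hs
    refine infinite_of_mem_nhds (0:ℝ) ?_
    filter_upwards [h1] with t ht
    simp only [hQ, eval_C]
    exact ht (fun y => (1 - M * ∑ i, (y i - c i) ^ 2) ^ k)
  have := hQ 1
  rw [hconst, eval_C] at this
  simp only [one_smul] at this
  exact this.symm

theorem smooth_surj {ι : Type*} [Fintype ι] [DecidableEq ι] (φ : (ι → ℝ) → (ι → ℝ))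
    (hφ : ContDiff ℝ 1 φ) (hs : ∀ x, 1 ≤ ‖x‖ → φ x = 0) (c : ι → ℝ) (hc : ‖c‖ < 1)
    (hne : ∀ x, x + φ x ≠ c) : False := by
  have hφc := hφ.continuous
  set B := closedBall (0 : ι → ℝ) 1 with hB
  have hBc : IsCompact B := isCompact_closedBall _ _
  have hBm : MeasurableSet B := isClosed_closedBall.measurableSet
  let u : (ι → ℝ) → ℝ := fun y => ∑ i, (y i - c i) ^ 2
  have hu : Continuous u := by fun_prop
  have hu0 : ∀ y, 0 ≤ u y := fun y => Finset.sum_nonneg fun i _ => sq_nonneg _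
  have hupos : ∀ y, y ≠ c → 0 < u y := by
    intro y hy
    refine lt_of_le_of_ne (hu0 y) fun h0 => hy ?_
    have h1 := (Finset.sum_eq_zero_iff_of_nonneg (fun i _ => sq_nonneg (y i - c i))).1 h0.symm
    ext i
    have := h1 i (Finset.mem_univ i)
    exact sub_eq_zero.1 (pow_eq_zero_iff (by norm_num) |>.1 this)
  have huF : Continuous fun x => u (x + φ x) := by fun_prop
  have hcB : c ∈ B := by simp [hB, hc.le]
  obtain ⟨x₀, hx₀, hmin⟩ := hBc.exists_isMinOn ⟨c, hcB⟩ huF.continuousOn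
  set η := u (x₀ + φ x₀) with hη
  have hη0 : 0 < η := hupos _ (hne x₀)
  obtain ⟨M₁, hM₁⟩ := hBc.bddAbove_image hu.continuousOn
  obtain ⟨M₂, hM₂⟩ := hBc.bddAbove_image huF.continuousOn
  set N := max (max M₁ M₂) 1 with hN
  have hN0 : 0 < N := lt_of_lt_of_le one_pos (le_max_right _ _)
  have hu1 : ∀ x ∈ B, u x ≤ N := fun x hx =>
    (hM₁ (mem_image_of_mem _ hx)).trans ((le_max_left _ _).trans (le_max_left _ _))
  have hu2 : ∀ x ∈ B, u (x + φ x) ≤ N := fun x hx =>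
    (hM₂ (mem_image_of_mem (fun x => u (x + φ x)) hx)).trans
      ((le_max_right _ _).trans (le_max_left _ _))
  set M := N⁻¹ with hM
  have hM0 : 0 < M := inv_pos.2 hN0
  have hle : ∀ a, a ≤ N → M * a ≤ 1 := fun a ha => by
    calc M * a ≤ M * N := by gcongr
      _ = 1 := inv_mul_cancel₀ hN0.ne'
  set a := 1 - M * η with ha
  set b := 1 - M * (η / 2) with hb
  have ha0 : 0 ≤ a := by
    have := hle η (hu2 x₀ hx₀)
    linarith
  have hab : a < b := by
    have : M * (η/2) < M * η := by gcongr; linarith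
    linarith
  have hb0 : 0 < b := by linarith
  have hdc : Continuous fun x => (1 + jac φ x).det := by
    apply Continuous.matrix_det
    refine continuous_matrix fun i j => ?_
    have := jac_cont φ hφ i j
    simp only [Matrix.add_apply]
    fun_prop
  set D := ∫ x in B, |(1 + jac φ x).det| with hD
  set V := B ∩ {y | u y < η / 2} with hV
  have hVm : MeasurableSet V := hBm.inter (isOpen_lt hu continuous_const).measurableSet
  have hVpos : 0 < volume.real V := by
    have h1 : (ball (0 : ι → ℝ) 1 ∩ {y | u y < η / 2}) ⊆ V :=
      inter_subset_inter_left _ ball_subset_closedBall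
    have h2 : 0 < volume (ball (0 : ι → ℝ) 1 ∩ {y | u y < η / 2}) := by
      apply (isOpen_ball.inter (isOpen_lt hu continuous_const)).measure_pos volume
      refine ⟨c, by simpa using hc, ?_⟩
      simp only [mem_ofPred_eq, u]
      simpa using hη0
    refine ENNReal.toReal_pos (h2.trans_le (measure_mono h1)).ne' ?_
    exact ((measure_mono inter_subset_left).trans_lt hBc.measure_lt_top).ne
  have key : ∀ k : ℕ, b ^ k * volume.real V ≤ D * a ^ k := by
    intro k
    have hid := poly_id φ hφ hs c M k
    have hup : ∫ x in B, (1 + jac φ x).det * (1 - M * u (x + φ x)) ^ k ≤ D * a ^ k := by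
      rw [hD, ← integral_mul_const]
      apply setIntegral_mono_on
      · exact (by fun_prop : Continuous fun x => (1 + jac φ x).det * (1 - M * u (x + φ x)) ^ k)
          |>.continuousOn.integrableOn_compact hBc
      · exact (by fun_prop : Continuous fun x => |(1 + jac φ x).det| * a ^ k)
          |>.continuousOn.integrableOn_compact hBc
      · exact hBm
      · intro x hx
        have h1 := hle _ (hu2 x hx)
        have h2 : η ≤ u (x + φ x) := hmin hx
        have h3 : M * η ≤ M * u (x + φ x) := by gcongr
        have h4 : (1 - M * u (x + φ x)) ^ k ≤ a ^ k :=
          pow_le_pow_left₀ (by linarith) (by linarith) k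
        have h5 : 0 ≤ (1 - M * u (x + φ x)) ^ k := pow_nonneg (by linarith) k
        exact mul_le_mul (le_abs_self _) h4 h5 (abs_nonneg _)
    have hi : IntegrableOn (fun x => (1 - M * u x) ^ k) B :=
      (by fun_prop : Continuous fun x => (1 - M * u x) ^ k)
          |>.continuousOn.integrableOn_compact hBc
    have hlow : b ^ k * volume.real V ≤ ∫ x in B, (1 - M * u x) ^ k := by
      calc b ^ k * volume.real V = ∫ x in V, b ^ k := by simp [mul_comm]
        _ ≤ ∫ x in V, (1 - M * u x) ^ k := by
            apply setIntegral_mono_on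
            · exact (continuous_const.continuousOn.integrableOn_compact hBc).mono_set
                inter_subset_left
            · exact hi.mono_set inter_subset_left
            · exact hVm
            · intro x hx
              apply pow_le_pow_left₀ hb0.le
              have : u x ≤ η / 2 := le_of_lt hx.2
              have : M * u x ≤ M * (η / 2) := by gcongr
              linarith
        _ ≤ _ := by
            apply setIntegral_mono_set hi
            · refine (ae_restrict_iff' hBm).2 (Eventually.of_forall fun x hx => ?_)
              have := hle _ (hu1 x hx)
              exact pow_nonneg (by linarith) k
            · exact (inter_subset_left).eventuallyLE
    exact hlow.trans (hid.symm.le.trans hup)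
  have hlim : Tendsto (fun k : ℕ => D * (a / b) ^ k) atTop (𝓝 (D * 0)) :=
    (tendsto_pow_atTop_nhds_zero_of_lt_one (div_nonneg ha0 hb0.le)
      ((div_lt_one hb0).2 hab)).const_mul D
  rw [mul_zero] at hlim
  have : volume.real V ≤ 0 := by
    refine ge_of_tendsto' hlim fun k => ?_
    rw [div_pow, ← mul_div_assoc, le_div_iff₀ (pow_pos hb0 k), mul_comm]
    exact key k
  linarith

theorem no_retract {ι κ : Type*} [Fintype ι] [Fintype κ] (f : (ι → ℝ) → (κ → ℝ))
    (g : (κ → ℝ) → (ι → ℝ)) (hf : Continuous f) (hg : Continuous g)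
    (hgf : ∀ x, g (f x) = x) : Fintype.card ι ≤ Fintype.card κ := by
  classical
  by_contra! hlt
  obtain ⟨P, hP, hPg, -⟩ := hg.exists_contDiff_approx 1 (ε := fun _ => 1/4) continuous_const
    (fun _ => by norm_num)
  have hd : Dense (range P)ᶜ := ContDiff.dense_compl_range_of_finrank_lt_finrank
    (by simpa using hP) (by simpa using hlt)
  obtain ⟨c, hcP, hc⟩ := hd.exists_dist_lt (0 : ι → ℝ) (ε := 1/4) (by norm_num)
  let χ : (ι → ℝ) → ℝ := fun x => max 0 (min 1 (2 - 2 * ‖x‖))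
  have hχ0 : ∀ x, 0 ≤ χ x := fun x => le_max_left _ _
  have hχ1 : ∀ x, χ x ≤ 1 := fun x => max_le (by norm_num) (min_le_left _ _)
  let φ₀ : (ι → ℝ) → (ι → ℝ) := fun x => χ x • (P (f x) - x)
  have hφ₀ : Continuous φ₀ := by
    have := hP.continuous
    fun_prop
  have hne : ∀ x, x + φ₀ x ≠ c := by
    intro x hx
    by_cases h2 : ‖x‖ ≤ 1/2
    · have h1 : χ x = 1 := by
        simp only [χ]
        rw [min_eq_left (by linarith)]; norm_num
      apply hcP
      refine ⟨f x, ?_⟩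
      simpa [φ₀, h1] using hx
    · have h3 : ‖φ₀ x‖ ≤ 1/4 := by
        have := hPg (f x)
        rw [hgf, dist_eq_norm] at this
        simp only [φ₀, norm_smul, Real.norm_eq_abs, abs_of_nonneg (hχ0 x)]
        nlinarith [hχ0 x, hχ1 x, norm_nonneg (P (f x) - x)]
      have h4 : ‖x‖ ≤ ‖c‖ + ‖φ₀ x‖ := by
        have : x = c - φ₀ x := by rw [← hx]; simp
        calc ‖x‖ = ‖c - φ₀ x‖ := by rw [← this]
          _ ≤ _ := norm_sub_le _ _
      rw [dist_zero_left] at hc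
      linarith
  obtain ⟨φ, hφ, hφφ, hsupp⟩ := hφ₀.exists_contDiff_approx 1 (ε := fun x => dist (x + φ₀ x) c)
    (by fun_prop) (fun x => dist_pos.2 (hne x))
  refine smooth_surj φ (by simpa using hφ) ?_ c ?_ ?_
  · intro x hx
    by_contra h0
    apply hsupp h0
    have : χ x = 0 := by
      simp only [χ]
      apply max_eq_left
      exact (min_le_right _ _).trans (by linarith)
    simp [φ₀, this]
  · rw [dist_zero_left] at hc
    linarith
  · intro x hx
    have := hφφ x
    rw [← hx, dist_add_left, dist_comm] at this
    exact lt_irrefl _ this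

theorem block_le {d : ℕ} (h : (Fin d → ℝ) ≃ₜ (Fin d → ℝ)) (S T : Set (Fin d))
    (hadm : AdmissibleBlockPair (fun z => h z) S T) : S.ncard ≤ T.ncard := by
  classical
  let z0 := h.symm 0
  let e : (S → ℝ) → (Fin d → ℝ) := fun v j => if hj : j ∈ S then v ⟨j, hj⟩ else z0 j
  let e' : (T → ℝ) → (Fin d → ℝ) := fun v j => if hj : j ∈ T then v ⟨j, hj⟩ else 0
  have he : Continuous e := by
    refine continuous_pi fun j => ?_
    by_cases hj : j ∈ S <;> simp only [e, hj, dite_true, dite_false] <;> fun_prop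
  have he' : Continuous e' := by
    refine continuous_pi fun j => ?_
    by_cases hj : j ∈ T <;> simp only [e', hj, dite_true, dite_false] <;> fun_prop
  have := no_retract (ι := S) (κ := T) (fun v i => h (e v) i) (fun w i => h.symm (e' w) i)
    (by fun_prop) (by fun_prop) (by
      intro v
      have : e' (fun i => h (e v) i) = h (e v) := by
        ext i
        by_cases hi : i ∈ T
        · simp [e', hi]
        · have := hadm.2 i hi (e v) z0 (fun j hj => by
            have : j ∉ S := hj
            simp [e, this])
          simp only [e', hi, dite_false]
          simp only at this
          rw [this]
          simp [z0]
      ext i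
      simp only [this]
      simp [e])
  rwa [← Nat.card_eq_fintype_card, ← Nat.card_eq_fintype_card] at this

end Helpers

/-- For a homeomorphism `h`, an admissible block pair `(S, T)` has blocks of equal size. -/
theorem admissible_block_pair_card_eq
    (d : ℕ) (h : (Fin d → ℝ) ≃ₜ (Fin d → ℝ)) (S T : Set (Fin d))
    (hadm : AdmissibleBlockPair (fun z => h z) S T) :
    T.ncard = S.ncard := by
  have h1 := block_le h S T hadm
  have h2 := block_le h Sᶜ Tᶜ ⟨hadm.2, by simpa using hadm.1⟩
  have h3 := Set.ncard_add_ncard_compl S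
  have h4 := Set.ncard_add_ncard_compl T
  omega
end

section
/- Let d : ℕ and let h : (Fin d → ℝ) → (Fin d → ℝ). Let S, T, S', T' ⊆ Fin d and assume (S, T) and (S', T') are admissible block pairs for h. Then (S ∩ S', T ∩ T') and (S ∪ S', T ∪ T') are also admissible block pairs for h. -/
theorem dependsOnlyOn_inter_aux {d : ℕ} {Y : Type*} {F : (Fin d → ℝ) → Y} {A B : Set (Fin d)}
    (hA : DependsOnlyOn F A) (hB : DependsOnlyOn F B) : DependsOnlyOn F (A ∩ B) := by
  classical
  intro z z' hz
  have e1 : F z = F (fun j => if j ∈ A then z j else z' j) :=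
    hA _ _ (fun j hj => by simp [hj])
  have e2 : F (fun j => if j ∈ A then z j else z' j) = F z' := by
    refine hB _ _ (fun j hj => ?_)
    by_cases hjA : j ∈ A
    · simpa [hjA] using hz j ⟨hjA, hj⟩
    · simp [hjA]
  exact e1.trans e2

theorem dependsOnlyOn_mono_aux {d : ℕ} {Y : Type*} {F : (Fin d → ℝ) → Y} {A B : Set (Fin d)}
    (hA : DependsOnlyOn F A) (hAB : A ⊆ B) : DependsOnlyOn F B :=
  fun z z' hz => hA z z' (fun j hj => hz j (hAB hj))

/-- Admissible block pairs are closed under intersections and unions. -/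
theorem admissible_block_pair_inter_union
    (d : ℕ) (h : (Fin d → ℝ) → (Fin d → ℝ)) (S T S' T' : Set (Fin d))
    (h1 : AdmissibleBlockPair h S T) (h2 : AdmissibleBlockPair h S' T') :
    AdmissibleBlockPair h (S ∩ S') (T ∩ T') ∧
    AdmissibleBlockPair h (S ∪ S') (T ∪ T') := by
  obtain ⟨a1, b1⟩ := h1
  obtain ⟨a2, b2⟩ := h2
  refine ⟨⟨?_, ?_⟩, ⟨?_, ?_⟩⟩
  · rintro i ⟨hi, hi'⟩
    exact dependsOnlyOn_inter_aux (a1 i hi) (a2 i hi')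
  · intro i hi
    rw [Set.compl_inter] at hi ⊢
    rcases hi with hi | hi
    · exact dependsOnlyOn_mono_aux (b1 i hi) Set.subset_union_left
    · exact dependsOnlyOn_mono_aux (b2 i hi) Set.subset_union_right
  · rintro i (hi | hi)
    · exact dependsOnlyOn_mono_aux (a1 i hi) Set.subset_union_left
    · exact dependsOnlyOn_mono_aux (a2 i hi) Set.subset_union_right
  · intro i hi
    rw [Set.compl_union] at hi ⊢
    exact dependsOnlyOn_inter_aux (b1 i hi.1) (b2 i hi.2)
end

section
/- Let d : ℕ and let h : (Fin d → ℝ) → (Fin d → ℝ). Let S, T, S', T' ⊆ Fin d and assume (S, T) and (S', T') are admissible block pairs for h. Then ((S ∪ S') \ (S ∩ S'), (T ∪ T') \ (T ∩ T')) is also an admissible block pair for h; that is, the symmetric difference of the supports forms an admissible block pair with the symmetric difference of the feature blocks. -/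
theorem DependsOnlyOn.inter_mono {d : ℕ} {Y : Type*} {F : (Fin d → ℝ) → Y} {A B C : Set (Fin d)}
    (hA : DependsOnlyOn F A) (hB : DependsOnlyOn F B) (hC : A ∩ B ⊆ C) : DependsOnlyOn F C := by
  classical
  intro z z' hz
  have e1 : F z = F (fun j => if j ∈ A then z j else z' j) := by
    apply hA
    intro j hj
    simp [hj]
  rw [e1]
  apply hB
  intro j hj
  by_cases hjA : j ∈ A
  · simpa [hjA] using hz j (hC ⟨hjA, hj⟩)
  · simp [hjA]

/-- Admissible block pairs are closed under symmetric differences. -/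
theorem admissible_block_pair_symmDiff
    (d : ℕ) (h : (Fin d → ℝ) → (Fin d → ℝ)) (S T S' T' : Set (Fin d))
    (h1 : AdmissibleBlockPair h S T) (h2 : AdmissibleBlockPair h S' T') :
    AdmissibleBlockPair h ((S ∪ S') \ (S ∩ S')) ((T ∪ T') \ (T ∩ T')) := by
  obtain ⟨a, b⟩ := h1
  obtain ⟨a', b'⟩ := h2
  constructor
  · rintro i ⟨hi | hi, hn⟩
    · have hi' : i ∈ T'ᶜ := fun q => hn ⟨hi, q⟩
      exact (a i hi).inter_mono (b' i hi') (fun j hj => ⟨Or.inl hj.1, fun q => hj.2 q.2⟩)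
    · have hi' : i ∈ Tᶜ := fun q => hn ⟨q, hi⟩
      exact (b i hi').inter_mono (a' i hi) (fun j hj => ⟨Or.inr hj.2, fun q => hj.1 q.1⟩)
  · intro i hi
    by_cases hT : i ∈ T
    · have hT' : i ∈ T' := by
        by_contra q
        exact hi ⟨Or.inl hT, fun r => q r.2⟩
      exact (a i hT).inter_mono (a' i hT') (fun j hj q => q.2 hj)
    · have hT' : i ∈ T'ᶜ := fun q => hi ⟨Or.inr q, fun r => hT r.1⟩
      exact (b i hT).inter_mono (b' i hT') (fun j hj q => q.1.elim hj.1 hj.2)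
end

section
/- Let d : ℕ, let p : Fin d → Fin d, let g : Fin d → (ℝ → ℝ), and let h : (Fin d → ℝ) → (Fin d → ℝ) be defined by h z i = g i (z (p i)). If h is a bijection, then p is a permutation of Fin d and each g i is a bijection of ℝ. -/
/-- If the map `z ↦ (i ↦ g i (z (p i)))` is a bijection, then `p` is a permutation and each
component map `g i` is a bijection of `ℝ`. -/
theorem coordinatewise_bijective_iff
    (d : ℕ) (p : Fin d → Fin d) (g : Fin d → (ℝ → ℝ))
    (h : (Fin d → ℝ) → (Fin d → ℝ))
    (hdef : ∀ (z : Fin d → ℝ) (i : Fin d), h z i = g i (z (p i)))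
    (hbij : Function.Bijective h) :
    Function.Bijective p ∧ ∀ i, Function.Bijective (g i) := by
  have hsurj : Function.Surjective p := by
    intro j
    by_contra hj
    have hne : ∀ i, p i ≠ j := fun i hi => hj ⟨i, hi⟩
    have e : h (fun _ => 0) = h (Function.update (fun _ => 0) j 1) := by
      funext i
      rw [hdef, hdef, Function.update_of_ne (hne i)]
    have e2 := congrFun (hbij.1 e) j
    rw [Function.update_self] at e2
    exact zero_ne_one e2
  have hinj : Function.Injective p := Finite.injective_iff_surjective.mpr hsurj
  refine ⟨⟨hinj, hsurj⟩, fun i => ⟨fun a b hab => ?_, fun y => ?_⟩⟩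
  · have e : h (fun _ => a) = h (Function.update (fun _ => a) (p i) b) := by
      funext k
      rw [hdef, hdef]
      by_cases hk : k = i
      · subst hk
        rw [Function.update_self]
        exact hab
      · rw [Function.update_of_ne (fun hp => hk (hinj hp))]
    have e2 := congrFun (hbij.1 e) (p i)
    rw [Function.update_self] at e2
    exact e2
  · obtain ⟨z, hz⟩ := hbij.2 (fun _ => y)
    exact ⟨z (p i), by rw [← hdef, hz]⟩
end
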